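/- arXiv:2006.10257 — 2 statements merged into one kernel-verified Lean document; each statement's English description precedes it below -/
import Mathlib

section
/- Let P be a reduced knot projection (given by its Gauss code). If y(P) = 2, then t(P) = 2. -/
open List

/-- A (cyclic) word over the alphabet of crossings, representing a Gauss code. -/
abbrev Word := List ℕ

/-- A diagram: a finite multiset of cyclic words (its components). -/
abbrev Diagram := Multiset Word

/-- `w` is cyclically of the form `v`, i.e. some rotation of `w` equals `v`. -/
def CyclicForm (w v : Word) : Prop := ∃ n, w.rotate n = v

/-- A Gauss code of a knot projection: a nonempty cyclic double occurrence word,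
in which every crossing occurs exactly twice. -/
def IsKnotProj (w : Word) : Prop := w ≠ [] ∧ ∀ a ∈ w, w.count a = 2

/-- The crossing `a` is nugatory in `w`: `w` is cyclically of the form `a·u·a·v`
where no crossing occurs once in `u` and once in `v`. -/
def Nugatory (a : ℕ) (w : Word) : Prop :=
  ∃ u v, CyclicForm w ([a] ++ u ++ [a] ++ v) ∧
    ∀ x : ℕ, ¬ (u.count x = 1 ∧ v.count x = 1)

/-- A word is reducible when it has a nugatory crossing. -/
def Reducible (w : Word) : Prop := ∃ a, Nugatory a w

/-- A single splice at the crossing `a` on a diagram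
(`s = true`: Seifert splice, `s = false`: non-Seifert splice).
At a self-crossing `a` of a component `a·u·a·v`, the Seifert splice replaces it by
the two words `u`, `v`, the non-Seifert splice by the single word `u·reverse v`.
At a crossing shared by two components `a·p`, `a·q`, the Seifert splice merges them
into `p·q` (orientation-respecting concatenation), the non-Seifert splice into
`p·reverse q` (concatenation with one factor reversed). -/
def Splice (s : Bool) (a : ℕ) (D D' : Diagram) : Prop :=
  (∃ w u v, w ∈ D ∧ CyclicForm w ([a] ++ u ++ [a] ++ v) ∧
      D' = if s then u ::ₘ v ::ₘ D.erase w
           else (u ++ v.reverse) ::ₘ D.erase w) ∨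
  (∃ w₁ w₂ p q, w₁ ∈ D ∧ w₂ ∈ D.erase w₁ ∧
      CyclicForm w₁ ([a] ++ p) ∧ CyclicForm w₂ ([a] ++ q) ∧
      D' = (if s then p ++ q else p ++ q.reverse) ::ₘ (D.erase w₁).erase w₂)

/-- Sequential application of the listed splices (type, crossing) to a diagram. -/
def SpliceSeq : List (Bool × ℕ) → Diagram → Diagram → Prop
  | [], D, D' => D' = D
  | (s, a) :: L, D, D' => ∃ D'', Splice s a D D'' ∧ SpliceSeq L D'' D'

/-- `n` splices of the allowed kinds, applied simultaneously (i.e. at pairwise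
distinct crossings) to the knot projection `w`, yield the single-component word `w'`. -/
def SimulSplice (allowed : Bool → Prop) (n : ℕ) (w w' : Word) : Prop :=
  ∃ L : List (Bool × ℕ), L.length = n ∧ (L.map Prod.snd).Nodup ∧
    (∀ p ∈ L, allowed p.1) ∧ SpliceSeq L {w} {w'}

/-- `t(P)`: the minimum number of splices (of either type), applied simultaneously,
needed to obtain a single-component reducible word from `w`. -/
noncomputable def tRed (w : Word) : ℕ :=
  sInf {n | ∃ w', SimulSplice (fun _ => True) n w w' ∧ Reducible w'}

/-- `y(P)`: the minimum number of non-Seifert splices, applied simultaneously,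
needed to obtain a single-component reducible word from `w`. -/
noncomputable def yRed (w : Word) : ℕ :=
  sInf {n | ∃ w', SimulSplice (fun s => s = false) n w w' ∧ Reducible w'}

/-- `i(P)`: the minimum number of Seifert splices, applied simultaneously,
needed to obtain a single-component reducible word from `w`. -/
noncomputable def iRed (w : Word) : ℕ :=
  sInf {n | ∃ w', SimulSplice (fun s => s = true) n w w' ∧ Reducible w'}

/-- One non-Seifert splice at a self-crossing of a knot projection:
`a·u·a·v` becomes `u·reverse v`. -/
def NonSeifert1 (w w' : Word) : Prop :=
  ∃ a u v, CyclicForm w ([a] ++ u ++ [a] ++ v) ∧ w' = u ++ v.reverse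

/-- `n` non-Seifert splices applied recursively (one at a time). -/
def NonSeifertIter : ℕ → Word → Word → Prop
  | 0, w, w' => w' = w
  | n + 1, w, w' => ∃ w'', NonSeifert1 w w'' ∧ NonSeifertIter n w'' w'

/-- Shimizu's reductivity `r(P)`: the minimum number of non-Seifert splices,
applied recursively, needed to obtain a reducible knot projection from `w`. -/
noncomputable def rRed (w : Word) : ℕ :=
  sInf {n | ∃ w', NonSeifertIter n w w' ∧ Reducible w'}

/-- A Seifert splice turns a single component into two, so it never yields a single component. -/
lemma not_splice_true_singleton (a : ℕ) (w w' : Word) : ¬ Splice true a {w} {w'} := by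
  rintro (⟨x, u, v, hx, -, h⟩ | ⟨w₁, w₂, p, q, h₁, h₂, -⟩)
  · have := congrArg Multiset.card h
    simp at this
  · obtain rfl := Multiset.mem_singleton.1 h₁
    simp at h₂

lemma SimulSplice.mono {A B : Bool → Prop} (hAB : ∀ s, A s → B s) {n : ℕ} {w w' : Word}
    (h : SimulSplice A n w w') : SimulSplice B n w w' := by
  obtain ⟨L, hn, hd, hL, hs⟩ := h
  exact ⟨L, hn, hd, fun p hp => hAB _ (hL p hp), hs⟩

lemma SimulSplice.eq_of_zero {A : Bool → Prop} {w w' : Word} (h : SimulSplice A 0 w w') :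
    w' = w := by
  obtain ⟨L, hn, -, -, hs⟩ := h
  obtain rfl := List.length_eq_zero_iff.1 hn
  exact Multiset.singleton_inj.1 hs

/-- A one-splice path between single components uses a non-Seifert splice. -/
lemma SimulSplice.nonSeifert_of_one {A : Bool → Prop} {w w' : Word} (h : SimulSplice A 1 w w') :
    SimulSplice (fun s => s = false) 1 w w' := by
  obtain ⟨L, hn, hd, -, hs⟩ := h
  obtain ⟨⟨s, a⟩, rfl⟩ := List.length_eq_one_iff.1 hn
  refine ⟨[(s, a)], hn, hd, ?_, hs⟩
  obtain ⟨D, hD, rfl⟩ := hs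
  cases s
  · simp
  · exact absurd hD (not_splice_true_singleton a w w')

/-- For a reduced knot projection `P`, if `y(P) = 2` then `t(P) = 2`. -/
theorem yRed_two_imp_tRed_two (w : Word) (hw : IsKnotProj w)
    (hred : ¬ Reducible w) (h : yRed w = 2) : tRed w = 2 := by
  have hy : IsLeast {n | ∃ w', SimulSplice (fun s => s = false) n w w' ∧ Reducible w'} 2 := by
    rw [← h]
    have hne := Nat.nonempty_of_sInf_eq_succ (show yRed w = 1 + 1 from h)
    exact ⟨Nat.sInf_mem hne, fun _ hn => Nat.sInf_le hn⟩
  refine IsLeast.csInf_eq ⟨?_, ?_⟩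
  · obtain ⟨w', hs, hr⟩ := hy.1
    exact ⟨w', hs.mono fun _ _ => trivial, hr⟩
  · rintro n ⟨w', hs, hr⟩
    match n, hs with
    | 0, hs => exact absurd (hs.eq_of_zero ▸ hr) hred
    | 1, hs => exact hy.2 ⟨w', hs.nonSeifert_of_one, hr⟩
    | n + 2, _ => exact Nat.le_add_left 2 n
end

section
/- Let P be a reduced knot projection whose Gauss code is cyclically of the form a·u·b·a·v·b for distinct crossings a, b and (possibly empty) subwords u, v (this is the configuration in which a simple closed curve meets P in exactly the two double points a and b as in Fig. rf6). Then t(P) = r(P) = y(P) = 1. -/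
open List

theorem Nat.sInf_eq_one_of_mem {S : Set ℕ} (h1 : 1 ∈ S) (h0 : 0 ∉ S) : sInf S = 1 := by
  refine le_antisymm (Nat.sInf_le h1) (Nat.one_le_iff_ne_zero.2 fun h => ?_)
  exact h0 (h ▸ Nat.sInf_mem ⟨1, h1⟩)

/-- A word with two adjacent occurrences of the same letter is reducible. -/
theorem reducible_of_adjacent (b : ℕ) (u v : Word) : Reducible (u ++ ([b] ++ [b] ++ v)) := by
  refine ⟨b, [], v ++ u, ⟨u.length, ?_⟩, by simp⟩
  rw [List.rotate_append_length_eq]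
  simp

theorem simulSplice_zero {allowed : Bool → Prop} {w w' : Word}
    (h : SimulSplice allowed 0 w w') : w' = w := by
  obtain ⟨L, hL, -, -, hs⟩ := h
  obtain rfl := List.length_eq_zero_iff.1 hL
  exact Multiset.singleton_inj.1 hs

theorem simulSplice_one_nonSeifert {allowed : Bool → Prop} (hallowed : allowed false)
    {w u v : Word} {a : ℕ} (h : CyclicForm w ([a] ++ u ++ [a] ++ v)) :
    SimulSplice allowed 1 w (u ++ v.reverse) := by
  refine ⟨[(false, a)], rfl, by simp, by simpa using hallowed, _, Or.inl ?_, rfl⟩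
  exact ⟨w, u, v, by simp, h, by simp⟩

/-- If a reduced knot projection `P` is cyclically of the form
`a·u·b·a·v·b` for distinct crossings `a`, `b` (the configuration of Fig. rf6),
then `t(P) = r(P) = y(P) = 1`. -/
theorem red_one_of_rf6 (w : Word) (a b : ℕ) (u v : Word)
    (hw : IsKnotProj w) (hred : ¬ Reducible w) (hab : a ≠ b)
    (h : CyclicForm w ([a] ++ u ++ [b] ++ [a] ++ v ++ [b])) :
    tRed w = 1 ∧ rRed w = 1 ∧ yRed w = 1 := by
  have hform : CyclicForm w ([a] ++ (u ++ [b]) ++ [a] ++ (v ++ [b])) := by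
    simpa only [List.append_assoc] using h
  have hred' : Reducible ((u ++ [b]) ++ (v ++ [b]).reverse) := by
    simpa using reducible_of_adjacent b u v.reverse
  refine ⟨Nat.sInf_eq_one_of_mem ?_ ?_, Nat.sInf_eq_one_of_mem ?_ ?_,
    Nat.sInf_eq_one_of_mem ?_ ?_⟩
  · exact ⟨_, simulSplice_one_nonSeifert trivial hform, hred'⟩
  · rintro ⟨w', hs, hr⟩
    exact hred (simulSplice_zero hs ▸ hr)
  · exact ⟨_, ⟨_, ⟨a, _, _, hform, rfl⟩, rfl⟩, hred'⟩
  · rintro ⟨w', hs, hr⟩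
    exact hred ((show w' = w from hs) ▸ hr)
  · exact ⟨_, simulSplice_one_nonSeifert (allowed := fun s => s = false) rfl hform, hred'⟩
  · rintro ⟨w', hs, hr⟩
    exact hred (simulSplice_zero hs ▸ hr)
end
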